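/- arXiv:1904.01055 — 2 statements merged into one kernel-verified Lean document; each statement's English description precedes it below -/
import Mathlib

section
/- Let C ⊆ V, let v ∈ C, let t be a positive integer, and let η be the probability that a t-step lazy random walk in G started at v visits a vertex outside C. Then for every σ with η < σ < 1: ‖clip(p_v^t, σ − η)‖₂² ≥ ‖clip(q_v^t, σ)‖₂², where q_v^t is the distribution of the t-step walk restricted to C. -/
open scoped Classical

noncomputable section

/-- Transition matrix of the lazy random walk on `G` with step probability `1/(2d)`. -/
def lazyStep {V : Type*} [Fintype V] [DecidableEq V] (G : SimpleGraph V) [DecidableRel G.Adj]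
    (d : ℕ) : Matrix V V ℝ :=
  Matrix.of fun u v =>
    if G.Adj u v then 1 / (2 * d)
    else if u = v then 1 - (G.degree u : ℝ) / (2 * d)
    else 0

/-- `walkDist G d t s v` is the probability that the `t`-step lazy random walk from `s` ends
at `v`. -/
def walkDist {V : Type*} [Fintype V] [DecidableEq V] (G : SimpleGraph V) [DecidableRel G.Adj]
    (d t : ℕ) (s : V) : V → ℝ :=
  fun v => (lazyStep G d ^ t) s v

/-- The squared `ξ`-clipped `ℓ₂`-norm of a nonnegative vector `x`: the least squared `ℓ₂`-norm
of a vector `y` with `0 ≤ y ≤ x` entrywise and `‖x - y‖₁ ≤ ξ`. -/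
def clipNormSq {W : Type*} [Fintype W] (x : W → ℝ) (ξ : ℝ) : ℝ :=
  sInf { r : ℝ | ∃ y : W → ℝ, (∀ v, 0 ≤ y v ∧ y v ≤ x v) ∧ (∑ v, |x v - y v|) ≤ ξ ∧
    r = ∑ v, y v ^ 2 }

/-- The probability of a particular trajectory `w` of `t` steps of the lazy random walk. -/
def walkProb {V : Type*} [Fintype V] [DecidableEq V] (G : SimpleGraph V) [DecidableRel G.Adj]
    (d t : ℕ) (w : Fin (t + 1) → V) : ℝ :=
  ∏ i : Fin t, lazyStep G d (w i.castSucc) (w i.succ)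

/-- Transition matrix of the lazy random walk restricted to `C`: transitions leaving `C` are
turned into extra self-loop probability. -/
def restrictedStep {V : Type*} [Fintype V] [DecidableEq V] (G : SimpleGraph V)
    [DecidableRel G.Adj] (d : ℕ) (C : Finset V) : Matrix C C ℝ :=
  Matrix.of fun u v =>
    if (u : V) = (v : V) then
      1 - (G.degree (u : V) : ℝ) / (2 * d) +
        ((Finset.univ.filter fun w => G.Adj (u : V) w ∧ w ∉ C).card : ℝ) / (2 * d)
    else if G.Adj (u : V) (v : V) then 1 / (2 * d)
    else 0

/-- `restrictedWalkDist G d C t s v`: the probability that the `t`-step lazy walk restricted to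
`C`, started at `s ∈ C`, ends at `v ∈ C`. -/
def restrictedWalkDist {V : Type*} [Fintype V] [DecidableEq V] (G : SimpleGraph V)
    [DecidableRel G.Adj] (d : ℕ) (C : Finset V) (t : ℕ) (s : C) : C → ℝ :=
  fun v => (restrictedStep G d C ^ t) s v

/-- The probability that the `t`-step lazy walk in `G` from `s` visits some vertex outside
`C`. -/
def escapeProb {V : Type*} [Fintype V] [DecidableEq V] (G : SimpleGraph V) [DecidableRel G.Adj]
    (d : ℕ) (C : Finset V) (s : V) (t : ℕ) : ℝ :=
  ∑ w : Fin (t + 1) → V, if w 0 = s ∧ ∃ i, w i ∉ C then walkProb G d t w else 0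

open Finset

theorem Matrix.sum_walks_eq_sum_pow {V R : Type*} [Fintype V] [DecidableEq V] [CommSemiring R]
    (M : Matrix V V R) (t : ℕ) (s : V) :
    (∑ w : Fin (t + 1) → V, if w 0 = s then ∏ i : Fin t, M (w i.castSucc) (w i.succ) else 0) =
      ∑ u, (M ^ t) s u := by
  induction t generalizing s with
  | zero =>
    rw [← (Equiv.funUnique (Fin 1) V).symm.sum_comp]
    simp [Matrix.one_apply]
  | succ t ih =>
    rw [← (Fin.consEquiv fun _ : Fin (t + 2) => V).sum_comp, Fintype.sum_prod_type]
    have h (a : V) (w : Fin (t + 1) → V) :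
        (∏ i : Fin (t + 1), M ((Fin.cons a w : Fin (t + 2) → V) i.castSucc)
          ((Fin.cons a w : Fin (t + 2) → V) i.succ)) =
        M a (w 0) * ∏ i : Fin t, M (w i.castSucc) (w i.succ) := by
      simp [Fin.prod_univ_succ]
    simp only [Fin.consEquiv_apply, h, Fin.cons_zero]
    rw [Fintype.sum_eq_single s fun a ha => by simp [ha]]
    simp only [if_true, pow_succ', Matrix.mul_apply]
    rw [sum_comm]
    simp only [← mul_sum, ← ih]
    simp only [mul_sum]
    rw [sum_comm]
    simp

theorem Matrix.sum_pow_apply_eq_one {V R : Type*} [Fintype V] [DecidableEq V] [Semiring R]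
    (M : Matrix V V R) (h : ∀ u, ∑ v, M u v = 1) (t : ℕ) (s : V) : ∑ v, (M ^ t) s v = 1 := by
  induction t generalizing s with
  | zero => simp [Matrix.one_apply]
  | succ t ih =>
    simp only [pow_succ', Matrix.mul_apply]
    rw [sum_comm]
    simp [← mul_sum, ih, h]

theorem Matrix.pow_apply_le_pow_apply {V : Type*} [Fintype V] [DecidableEq V]
    {M N : Matrix V V ℝ} (h₀ : ∀ u v, 0 ≤ M u v) (h : ∀ u v, M u v ≤ N u v) (t : ℕ) (u v : V) :
    (M ^ t) u v ≤ (N ^ t) u v := by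
  induction t generalizing u with
  | zero => simp
  | succ t ih =>
    rw [pow_succ', pow_succ', Matrix.mul_apply, Matrix.mul_apply]
    exact sum_le_sum fun w _ => mul_le_mul (h u w) (ih w) (pow_apply_nonneg h₀ t w v)
      ((h₀ u w).trans (h u w))

theorem clipNormSq_le {W : Type*} [Fintype W] {x y : W → ℝ} {ξ : ℝ}
    (hy : ∀ v, 0 ≤ y v ∧ y v ≤ x v) (hξ : ∑ v, |x v - y v| ≤ ξ) :
    clipNormSq x ξ ≤ ∑ v, y v ^ 2 := by
  refine csInf_le ⟨0, ?_⟩ ⟨y, hy, hξ, rfl⟩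
  rintro _ ⟨z, -, -, rfl⟩
  positivity

section Walk

variable {V : Type*} [Fintype V] [DecidableEq V] (G : SimpleGraph V) [DecidableRel G.Adj] {d : ℕ}

theorem lazyStep_apply (d : ℕ) (u v : V) :
    lazyStep G d u v = (if G.Adj u v then 1 / (2 * d : ℝ) else 0) +
      if u = v then 1 - (G.degree u : ℝ) / (2 * d) else 0 := by
  rw [lazyStep, Matrix.of_apply]
  by_cases h : u = v
  · subst h; simp
  · simp [h]

theorem lazyStep_nonneg (hd : 1 ≤ d) (hdeg : ∀ v, G.degree v ≤ d) (u v : V) :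
    0 ≤ lazyStep G d u v := by
  have hd' : (1 : ℝ) ≤ d := by exact_mod_cast hd
  have hu : (G.degree u : ℝ) ≤ d := by exact_mod_cast hdeg u
  have : (G.degree u : ℝ) / (2 * d) ≤ 1 := by rw [div_le_one (by positivity)]; linarith
  rw [lazyStep, Matrix.of_apply]
  split_ifs
  · positivity
  · linarith
  · rfl

theorem sum_lazyStep (d : ℕ) (u : V) : ∑ v, lazyStep G d u v = 1 := by
  simp only [lazyStep_apply, sum_add_distrib, sum_ite_eq, mem_univ, if_true]
  rw [← sum_filter, sum_const, ← G.neighborFinset_eq_filter, G.card_neighborFinset_eq_degree,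
    nsmul_eq_mul]
  ring

theorem restrictedStep_apply (d : ℕ) (C : Finset V) (u v : C) :
    restrictedStep G d C u v = lazyStep G d u v +
      if u = v then ∑ w with w ∉ C, lazyStep G d u w else 0 := by
  have h : ∑ w with w ∉ C, lazyStep G d u w =
      (#{w | G.Adj (u : V) w ∧ w ∉ C} : ℝ) / (2 * d) := by
    have : ∀ w ∈ univ.filter (· ∉ C), lazyStep G d u w =
        if G.Adj u w then 1 / (2 * d : ℝ) else 0 := by
      intro w hw
      have : (u : V) ≠ w := by rintro rfl; simp at hw
      simp [lazyStep_apply, this]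
    rw [sum_congr rfl this, ← sum_filter, filter_filter, sum_const, nsmul_eq_mul, mul_one_div]
    simp only [and_comm]
  rw [h, lazyStep_apply, restrictedStep, Matrix.of_apply]
  by_cases huv : u = v
  · subst huv; simp
  · simp [huv, Subtype.coe_injective.ne huv]

theorem sum_restrictedStep (d : ℕ) (C : Finset V) (u : C) :
    ∑ v, restrictedStep G d C u v = 1 := by
  simp only [restrictedStep_apply, sum_add_distrib, sum_ite_eq, mem_univ, if_true]
  rw [sum_coe_sort C fun v => lazyStep G d u v, ← sum_lazyStep G d u,
    ← sum_filter_add_sum_filter_not univ (· ∈ C)]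
  simp

/-- Transition matrix of the lazy random walk killed when it leaves `C`. -/
def killedStep (d : ℕ) (C : Finset V) : Matrix V V ℝ :=
  Matrix.of fun u v => if v ∈ C then lazyStep G d u v else 0

theorem killedStep_nonneg (hd : 1 ≤ d) (hdeg : ∀ v, G.degree v ≤ d) (C : Finset V) (u v : V) :
    0 ≤ killedStep G d C u v := by
  rw [killedStep, Matrix.of_apply]
  split_ifs
  · exact lazyStep_nonneg G hd hdeg u v
  · rfl

theorem killedStep_le_lazyStep (hd : 1 ≤ d) (hdeg : ∀ v, G.degree v ≤ d) (C : Finset V)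
    (u v : V) : killedStep G d C u v ≤ lazyStep G d u v := by
  rw [killedStep, Matrix.of_apply]
  split_ifs
  · rfl
  · exact lazyStep_nonneg G hd hdeg u v

theorem killedStep_pow_apply_of_notMem (d : ℕ) {C : Finset V} {u v : V} (hu : u ∈ C)
    (hv : v ∉ C) (t : ℕ) : (killedStep G d C ^ t) u v = 0 := by
  cases t with
  | zero => simp [ne_of_mem_of_not_mem hu hv]
  | succ t => simp [pow_succ, Matrix.mul_apply, killedStep, hv]

theorem killedStep_le_restrictedStep (hd : 1 ≤ d) (hdeg : ∀ v, G.degree v ≤ d) (C : Finset V)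
    (u v : C) : killedStep G d C u v ≤ restrictedStep G d C u v := by
  rw [restrictedStep_apply]
  refine (killedStep_le_lazyStep G hd hdeg C u v).trans (le_add_of_nonneg_right ?_)
  split_ifs
  · exact sum_nonneg fun w _ => lazyStep_nonneg G hd hdeg u w
  · rfl

theorem killedStep_pow_le_restrictedStep_pow (hd : 1 ≤ d) (hdeg : ∀ v, G.degree v ≤ d)
    (C : Finset V) (t : ℕ) (u v : C) :
    (killedStep G d C ^ t) u v ≤ (restrictedStep G d C ^ t) u v := by
  induction t generalizing u with
  | zero => simp [Matrix.one_apply]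
  | succ t ih =>
    rw [pow_succ', pow_succ', Matrix.mul_apply, Matrix.mul_apply,
      ← sum_subset (subset_univ C) fun w _ hw => by simp [killedStep, hw],
      ← sum_coe_sort C]
    refine sum_le_sum fun w _ => ?_
    exact mul_le_mul (killedStep_le_restrictedStep G hd hdeg C u w) (ih w)
      (Matrix.pow_apply_nonneg (killedStep_nonneg G hd hdeg C) t _ _)
      ((killedStep_nonneg G hd hdeg C u w).trans (killedStep_le_restrictedStep G hd hdeg C u w))

theorem sum_killedStep_pow_add_escapeProb (d : ℕ) {C : Finset V} {s : V} (hs : s ∈ C) (t : ℕ) :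
    ∑ u, (killedStep G d C ^ t) s u + escapeProb G d C s t = 1 := by
  rw [← Matrix.sum_pow_apply_eq_one (lazyStep G d) (sum_lazyStep G d) t s,
    ← Matrix.sum_walks_eq_sum_pow, ← Matrix.sum_walks_eq_sum_pow, escapeProb,
    ← sum_add_distrib]
  refine sum_congr rfl fun w _ => ?_
  by_cases hw : w 0 = s
  · by_cases hC : ∃ i, w i ∉ C
    · have : ∏ i : Fin t, killedStep G d C (w i.castSucc) (w i.succ) = 0 := by
        obtain ⟨i, hi⟩ := hC
        cases i using Fin.cases with
        | zero => exact absurd (hw ▸ hs) hi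
        | succ i => exact prod_eq_zero (mem_univ i) (by simp [killedStep, hi])
      simp [hw, hC, this, walkProb]
    · have hC' : ∀ i, w i ∈ C := by simpa using hC
      simp [hw, hC', killedStep]
  · simp [hw]

end Walk

/-- clipped-norm comparison between the walk in `G` and the walk restricted
to `C`. -/
theorem clipNorm_restricted_le {V : Type} [Fintype V] [DecidableEq V] (G : SimpleGraph V)
    [DecidableRel G.Adj] (d : ℕ) (hd : 1 ≤ d) (hdeg : ∀ v, G.degree v ≤ d)
    (C : Finset V) (v : V) (hv : v ∈ C) (t : ℕ) (ht : 0 < t)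
    (η σ : ℝ) (hη : η = escapeProb G d C v t) (hησ : η < σ) (hσ : σ < 1) :
    clipNormSq (restrictedWalkDist G d C t ⟨v, hv⟩) σ ≤
      clipNormSq (walkDist G d t v) (σ - η) := by
  set K : V → ℝ := (killedStep G d C ^ t) v
  have hK₀ : ∀ u, 0 ≤ K u :=
    Matrix.pow_apply_nonneg (killedStep_nonneg G hd hdeg C) t v
  have hKp : ∀ u, K u ≤ walkDist G d t v u := Matrix.pow_apply_le_pow_apply
    (killedStep_nonneg G hd hdeg C) (killedStep_le_lazyStep G hd hdeg C) t v
  have hKq : ∀ u : C, K u ≤ restrictedWalkDist G d C t ⟨v, hv⟩ u :=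
    killedStep_pow_le_restrictedStep_pow G hd hdeg C t ⟨v, hv⟩
  have hKsum : ∑ u, K u + η = 1 := hη ▸ sum_killedStep_pow_add_escapeProb G d hv t
  have hq : ∑ u, restrictedWalkDist G d C t ⟨v, hv⟩ u = 1 :=
    Matrix.sum_pow_apply_eq_one _ (sum_restrictedStep G d C) t _
  refine le_csInf ⟨_, walkDist G d t v, fun u => ⟨(hK₀ u).trans (hKp u), le_rfl⟩, ?_, rfl⟩ ?_
  · simpa using hησ.le
  rintro _ ⟨y, hy, hyσ, rfl⟩
  have hz : ∑ u, min (y u) (K u) = ∑ u : C, min (y u) (K u) := by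
    rw [sum_coe_sort C fun u => min (y u) (K u)]
    refine (sum_subset (subset_univ C) fun u _ hu => ?_).symm
    have hKu : K u = 0 := killedStep_pow_apply_of_notMem G d hv hu t
    rw [hKu, min_eq_right (hy u).1]
  have hz₀ : ∀ u, 0 ≤ min (y u) (K u) := fun u => le_min (hy u).1 (hK₀ u)
  have hzq : ∀ u : C, min (y u) (K u) ≤ restrictedWalkDist G d C t ⟨v, hv⟩ u :=
    fun u => (min_le_right _ _).trans (hKq u)
  have hzK : ∑ u, K u - ∑ u, |walkDist G d t v u - y u| ≤ ∑ u, min (y u) (K u) := by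
    rw [← sum_sub_distrib]
    refine sum_le_sum fun u _ => le_min ?_ ?_
    · linarith [le_abs_self (walkDist G d t v u - y u), hKp u]
    · linarith [abs_nonneg (walkDist G d t v u - y u)]
  refine (clipNormSq_le (y := fun u : C => min (y u) (K u)) (fun u => ⟨hz₀ u, hzq u⟩) ?_).trans ?_
  · rw [sum_congr rfl fun u _ => abs_of_nonneg (sub_nonneg.2 (hzq u)), sum_sub_distrib, hq, ← hz]
    linarith
  · rw [sum_coe_sort C fun u => min (y u) (K u) ^ 2]
    refine (sum_le_univ_sum_of_nonneg fun u => sq_nonneg _).trans (sum_le_sum fun u _ => ?_)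
    exact pow_le_pow_left₀ (hz₀ u) (min_le_left _ _) 2
end
end

section
/- There is an absolute constant α > 0 such that the following holds. Let H be a graph on r vertices and let G be an H-minor-free simple graph on n vertices with maximum degree at most d. Then for every integer ℓ ≥ α·r³ there exists a set R of at most α·d·n/ℓ³ edges of G whose removal leaves a graph in which every connected component has at most r³·ℓ⁶ vertices. -/
open scoped Classical

noncomputable section

/-- `G` contains an `H`-minor: there are disjoint nonempty connected branch sets in `G`,
one for each vertex of `H`, with adjacent branch sets for each edge of `H`. -/
def HasMinor {V W : Type*} (G : SimpleGraph V) (H : SimpleGraph W) : Prop :=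
  ∃ B : W → Set V,
    (∀ w, (B w).Nonempty) ∧
    (∀ w, (G.induce (B w)).Connected) ∧
    (Pairwise fun w w' => Disjoint (B w) (B w')) ∧
    ∀ w w', H.Adj w w' → ∃ u ∈ B w, ∃ v ∈ B w', G.Adj u v

/-- A cut-based form of connectedness for the subgraph induced on a finset. -/
def CutConnected {V : Type*} (G : SimpleGraph V) (T : Finset V) : Prop :=
  T.Nonempty ∧ ∀ P : Finset V, (∃ v ∈ T, v ∈ P) →
    (∀ u ∈ T, u ∈ P → ∀ w ∈ T, G.Adj u w → w ∈ P) → T ⊆ P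

namespace CutConnected

variable {V : Type*} {G : SimpleGraph V}

theorem singleton (v : V) : CutConnected G {v} := by
  refine ⟨Finset.singleton_nonempty v, fun P ⟨w, hw, hwP⟩ _ => ?_⟩
  rw [Finset.mem_singleton] at hw
  subst hw
  simpa using hwP

theorem insert_of_adj {T : Finset V} (hT : CutConnected G T) {v w : V} (hv : v ∈ T)
    (h : G.Adj v w) : CutConnected G (insert w T) := by
  refine ⟨Finset.insert_nonempty _ _, fun P ⟨x, hx, hxP⟩ hP => ?_⟩
  have key : ∀ x ∈ T, x ∈ P → insert w T ⊆ P := by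
    intro x hx hxP
    have hTP : T ⊆ P := hT.2 P ⟨x, hx, hxP⟩ fun a ha haP b hb hab =>
      hP a (Finset.mem_insert_of_mem ha) haP b (Finset.mem_insert_of_mem hb) hab
    exact Finset.insert_subset (hP v (Finset.mem_insert_of_mem hv) (hTP hv) w
      (Finset.mem_insert_self _ _) h) hTP
  rcases Finset.mem_insert.1 hx with rfl | hx
  · exact key v hv (hP x (Finset.mem_insert_self _ _) hxP v (Finset.mem_insert_of_mem hv) h.symm)
  · exact key x hx hxP

/-- Every vertex of `S` lies in a connected component of the subgraph induced on `S`. -/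
theorem exists_component {S : Finset V} {v : V} (hv : v ∈ S) :
    ∃ C ⊆ S, v ∈ C ∧ CutConnected G C ∧ ∀ u ∈ C, ∀ w ∈ S, G.Adj u w → w ∈ C := by
  obtain ⟨C, hC, hmax⟩ := Finset.exists_max_image
    (S.powerset.filter fun C => v ∈ C ∧ CutConnected G C) Finset.card
    ⟨{v}, by simp [hv, singleton]⟩
  simp only [Finset.mem_filter, Finset.mem_powerset] at hC hmax
  refine ⟨C, hC.1, hC.2.1, hC.2.2, fun u hu w hw huw => ?_⟩
  by_contra hwC
  have := hmax (insert w C) ⟨Finset.insert_subset hw hC.1, Finset.mem_insert_of_mem hC.2.1,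
    hC.2.2.insert_of_adj hu huw⟩
  rw [Finset.card_insert_of_notMem hwC] at this
  omega

theorem connected_induce {T : Finset V} (hT : CutConnected G T) :
    (G.induce (T : Set V)).Connected := by
  obtain ⟨v, hv⟩ := hT.1
  have key : ∀ w (hw : w ∈ T),
      (G.induce (T : Set V)).Reachable ⟨v, hv⟩ ⟨w, hw⟩ := by
    have := hT.2 (T.filter fun w => ∃ hw : w ∈ T,
      (G.induce (T : Set V)).Reachable ⟨v, hv⟩ ⟨w, hw⟩) ⟨v, hv, by simp [hv]⟩ ?_
    · intro w hw
      exact (Finset.mem_filter.1 (this hw)).2.2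
    · intro a ha haP b hb hab
      obtain ⟨-, ha', hr⟩ := Finset.mem_filter.1 haP
      refine Finset.mem_filter.2 ⟨hb, hb, hr.trans (SimpleGraph.Adj.reachable ?_)⟩
      exact hab
  have : Nonempty (T : Set V) := ⟨⟨v, hv⟩⟩
  exact SimpleGraph.Connected.mk fun a b => (key a a.2).symm.trans (key b b.2)

theorem of_connected_induce {T : Finset V} (hT : (G.induce (T : Set V)).Connected) :
    CutConnected G T := by
  obtain ⟨x⟩ := hT.nonempty
  refine ⟨⟨x, x.2⟩, fun P ⟨v, hv, hvP⟩ hP w hw => ?_⟩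
  obtain ⟨p⟩ := hT.preconnected ⟨v, hv⟩ ⟨w, hw⟩
  have key : ∀ (a b : (T : Set V)), (G.induce (T : Set V)).Walk a b → a.1 ∈ P → b.1 ∈ P := by
    intro a b p
    induction p with
    | nil => exact id
    | cons h _ ih => exact fun ha => ih (hP _ (Subtype.coe_prop _) ha _ (Subtype.coe_prop _) h)
  exact key _ _ p hvP

end CutConnected

/-- Either few vertices of `B` form a connected set meeting all of `A 0, …, A (k - 1)`, or few
vertices of `B` separate these sets. -/
theorem exists_connected_or_separator {V : Type*} (G : SimpleGraph V) (B : Finset V)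
    (A : ℕ → Finset V) (k t : ℕ) (ht : 1 ≤ t) :
    (∃ T ⊆ B, CutConnected G T ∧ T.card ≤ t ∧ ∀ j < k, ∃ x ∈ T, x ∈ A j) ∨
    ∃ Z ⊆ B, t * Z.card ≤ k * B.card ∧
      ∀ K ⊆ B, CutConnected G K → Disjoint K Z → ∃ j < k, Disjoint K (A j) := by
  by_cases hT : ∃ T ⊆ B, CutConnected G T ∧ T.card ≤ t ∧ ∀ j < k, ∃ x ∈ T, x ∈ A j
  · exact Or.inl hT
  refine Or.inr ?_
  let P : ℕ → V → ℕ → Prop := fun i v s =>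
    ∃ T ⊆ B, CutConnected G T ∧ T.card ≤ s ∧ v ∈ T ∧ ∀ j < i, ∃ x ∈ T, x ∈ A j
  have Pmono : ∀ {i v s s'}, s ≤ s' → P i v s → P i v s' :=
    fun h ⟨T, h1, h2, h3, h4⟩ => ⟨T, h1, h2, h3.trans h, h4⟩
  let L : ℕ → ℕ → Finset V := fun s i => B.filter fun v => P i v (s + 1) ∧ ¬ P i v s
  let Z : ℕ → Finset V := fun s => (Finset.range k).biUnion fun i => L s (i + 1)
  have hL : ∀ i, ∑ s ∈ Finset.range t, (L s i).card ≤ B.card := by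
    intro i
    rw [← Finset.card_biUnion]
    · exact Finset.card_le_card (Finset.biUnion_subset.2 fun s _ => Finset.filter_subset _ _)
    · have : ∀ s s', s < s' → Disjoint (L s i) (L s' i) := by
        intro s s' h
        rw [Finset.disjoint_left]
        intro v hv hv'
        exact (Finset.mem_filter.1 hv').2.2 (Pmono h (Finset.mem_filter.1 hv).2.1)
      intro s _ s' _ hne
      rcases lt_or_gt_of_ne hne with h | h
      · exact this _ _ h
      · exact (this _ _ h).symm
  have hZ : ∑ s ∈ Finset.range t, (Z s).card ≤ k * B.card :=
    calc ∑ s ∈ Finset.range t, (Z s).card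
        ≤ ∑ s ∈ Finset.range t, ∑ i ∈ Finset.range k, (L s (i + 1)).card :=
          Finset.sum_le_sum fun s _ => Finset.card_biUnion_le
      _ = ∑ i ∈ Finset.range k, ∑ s ∈ Finset.range t, (L s (i + 1)).card := Finset.sum_comm
      _ ≤ ∑ i ∈ Finset.range k, B.card := Finset.sum_le_sum fun i _ => hL _
      _ = k * B.card := by simp
  obtain ⟨s, hs, hsZ⟩ : ∃ s ∈ Finset.range t, t * (Z s).card ≤ k * B.card := by
    by_contra! h
    have h1 : ∑ s ∈ Finset.range t, k * B.card < ∑ s ∈ Finset.range t, t * (Z s).card :=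
      Finset.sum_lt_sum_of_nonempty ⟨0, by simp; omega⟩ h
    rw [Finset.sum_const, Finset.card_range, smul_eq_mul, ← Finset.mul_sum] at h1
    exact absurd (Nat.mul_le_mul_left t hZ) (not_le.2 h1)
  rw [Finset.mem_range] at hs
  refine ⟨Z s, Finset.biUnion_subset.2 fun i _ => Finset.filter_subset _ _, hsZ,
    fun K hKB hK hKZ => ?_⟩
  by_contra! hmeet
  have key : ∀ i ≤ k, ∀ v ∈ K, P i v (s + 1) := by
    intro i
    induction i with
    | zero =>
      intro _ v hv
      exact ⟨{v}, by simpa using hKB hv, .singleton v, by simp, by simp, by simp⟩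
    | succ i ih =>
      intro hi
      have hstep : ∀ v ∈ K, P (i + 1) v (s + 1) → P (i + 1) v s := by
        intro v hv hP
        by_contra hn
        refine Finset.disjoint_left.1 hKZ hv (Finset.mem_biUnion.2 ⟨i, by simp; omega, ?_⟩)
        exact Finset.mem_filter.2 ⟨hKB hv, hP, hn⟩
      obtain ⟨a, haK, haA⟩ := Finset.not_disjoint_iff.1 (hmeet i (by omega))
      have hsub := hK.2 (K.filter fun v => P (i + 1) v (s + 1)) ⟨a, haK, ?_⟩ ?_
      · exact fun v hv => (Finset.mem_filter.1 (hsub hv)).2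
      · obtain ⟨T, h1, h2, h3, h4, h5⟩ := ih (by omega) a haK
        refine Finset.mem_filter.2 ⟨haK, T, h1, h2, h3, h4, fun j hj => ?_⟩
        rcases Nat.lt_succ_iff_lt_or_eq.1 hj with hj | rfl
        · exact h5 j hj
        · exact ⟨a, h4, haA⟩
      · intro u hu huP w hw huw
        obtain ⟨T, h1, h2, h3, h4, h5⟩ := hstep u hu (Finset.mem_filter.1 huP).2
        refine Finset.mem_filter.2 ⟨hw, insert w T, Finset.insert_subset (hKB hw) h1,
          h2.insert_of_adj h4 huw, ?_, Finset.mem_insert_self _ _, fun j hj => ?_⟩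
        · exact (Finset.card_insert_le _ _).trans (by omega)
        · obtain ⟨x, hx, hxA⟩ := h5 j hj
          exact ⟨x, Finset.mem_insert_of_mem hx, hxA⟩
  obtain ⟨v, hv⟩ := hK.1
  obtain ⟨T, h1, h2, h3, -, h5⟩ := key k le_rfl v hv
  exact hT ⟨T, h1, h2, by omega, h5⟩

/-- Finset-indexed version of `exists_connected_or_separator`. -/
theorem exists_connected_or_separator' {V ι : Type*} (G : SimpleGraph V) (B : Finset V)
    (s : Finset ι) (A : ι → Finset V) (t : ℕ) (ht : 1 ≤ t) :
    (∃ T ⊆ B, CutConnected G T ∧ T.card ≤ t ∧ ∀ i ∈ s, ∃ x ∈ T, x ∈ A i) ∨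
    ∃ Z ⊆ B, t * Z.card ≤ s.card * B.card ∧
      ∀ K ⊆ B, CutConnected G K → Disjoint K Z → ∃ i ∈ s, Disjoint K (A i) := by
  let e := s.equivFin
  let A' : ℕ → Finset V := fun j => if h : j < s.card then A (e.symm ⟨j, h⟩) else ∅
  have hA' : ∀ i (hi : i ∈ s), A' (e ⟨i, hi⟩) = A i := by
    intro i hi
    simp [A']
  rcases exists_connected_or_separator G B A' s.card t ht with ⟨T, h1, h2, h3, h4⟩ | ⟨Z, h1, h2, h3⟩
  · refine Or.inl ⟨T, h1, h2, h3, fun i hi => ?_⟩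
    have := h4 (e ⟨i, hi⟩) (e ⟨i, hi⟩).2
    rwa [hA'] at this
  · refine Or.inr ⟨Z, h1, h2, fun K hKB hK hKZ => ?_⟩
    obtain ⟨j, hj, hd⟩ := h3 K hKB hK hKZ
    refine ⟨e.symm ⟨j, hj⟩, (e.symm ⟨j, hj⟩).2, ?_⟩
    simpa [A', hj] using hd

/-- A family of disjoint connected vertex sets, any two of them joined by an edge. -/
structure IsCovey {V : Type*} (G : SimpleGraph V) (F : Finset (Finset V)) : Prop where
  connected : ∀ C ∈ F, CutConnected G C
  disjoint : ∀ C ∈ F, ∀ D ∈ F, C ≠ D → Disjoint C D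
  adj : ∀ C ∈ F, ∀ D ∈ F, C ≠ D → ∃ u ∈ C, ∃ v ∈ D, G.Adj u v

theorem IsCovey.mono {V : Type*} {G : SimpleGraph V} {F F' : Finset (Finset V)}
    (hF : IsCovey G F) (h : F' ⊆ F) : IsCovey G F' :=
  ⟨fun C hC => hF.connected C (h hC), fun C hC D hD => hF.disjoint C (h hC) D (h hD),
    fun C hC D hD => hF.adj C (h hC) D (h hD)⟩

theorem IsCovey.insert {V : Type*} {G : SimpleGraph V} {F : Finset (Finset V)}
    (hF : IsCovey G F) {T : Finset V} (hT : CutConnected G T)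
    (hd : ∀ C ∈ F, Disjoint C T) (ha : ∀ C ∈ F, ∃ u ∈ C, ∃ v ∈ T, G.Adj u v) :
    IsCovey G (insert T F) := by
  refine ⟨?_, ?_, ?_⟩
  · intro C hC
    rcases Finset.mem_insert.1 hC with rfl | hC
    exacts [hT, hF.connected C hC]
  · intro C hC D hD hne
    rcases Finset.mem_insert.1 hC with rfl | hC' <;>
      rcases Finset.mem_insert.1 hD with rfl | hD'
    exacts [absurd rfl hne, (hd D hD').symm, hd C hC', hF.disjoint C hC' D hD' hne]
  · intro C hC D hD hne
    rcases Finset.mem_insert.1 hC with rfl | hC' <;>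
      rcases Finset.mem_insert.1 hD with rfl | hD'
    · exact absurd rfl hne
    · obtain ⟨u, hu, v, hv, h⟩ := ha D hD'
      exact ⟨v, hv, u, hu, h.symm⟩
    · exact ha C hC'
    · exact hF.adj C hC' D hD' hne

theorem IsCovey.hasMinor {V : Type*} {G : SimpleGraph V} {F : Finset (Finset V)}
    (hF : IsCovey G F) {r : ℕ} (hr : F.card = r) (H : SimpleGraph (Fin r)) : HasMinor G H := by
  subst hr
  let e := F.equivFin.symm
  have hne : ∀ w w', w ≠ w' → (e w).1 ≠ (e w').1 := fun w w' h h' =>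
    h (e.injective (Subtype.ext h'))
  refine ⟨fun w => ((e w).1 : Set V), fun w => ?_, fun w => ?_, fun w w' h => ?_,
    fun w w' h => ?_⟩
  · exact (hF.connected _ (e w).2).1
  · exact (hF.connected _ (e w).2).connected_induce
  · exact Finset.disjoint_coe.2 (hF.disjoint _ (e w).2 _ (e w').2 (hne _ _ h))
  · exact hF.adj _ (e w).2 _ (e w').2 (hne _ _ h.ne)

/-- A haven of order `m` in the subgraph induced on `U`. -/
structure IsHaven {V : Type*} (G : SimpleGraph V) (U : Finset V) (m : ℕ)
    (β : Finset V → Finset V) : Prop where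
  subset : ∀ X ⊆ U, X.card ≤ m → β X ⊆ U
  disjoint : ∀ X ⊆ U, X.card ≤ m → Disjoint (β X) X
  connected : ∀ X ⊆ U, X.card ≤ m → CutConnected G (β X)
  closed : ∀ X ⊆ U, X.card ≤ m → ∀ u ∈ β X, ∀ w ∈ U, w ∉ X → G.Adj u w → w ∈ β X
  anti : ∀ X Y, X ⊆ Y → Y ⊆ U → Y.card ≤ m → β Y ⊆ β X

theorem exists_isHaven {V : Type*} {G : SimpleGraph V} {U : Finset V} {m : ℕ}
    (h : ∀ X ⊆ U, X.card ≤ m →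
      ∃ D ⊆ U, Disjoint D X ∧ CutConnected G D ∧ U.card < 2 * D.card) :
    ∃ β, IsHaven G U m β := by
  have h' : ∀ X, X ⊆ U ∧ X.card ≤ m → ∃ D ⊆ U, Disjoint D X ∧ CutConnected G D ∧
      (∀ u ∈ D, ∀ w ∈ U, w ∉ X → G.Adj u w → w ∈ D) ∧ U.card < 2 * D.card := by
    rintro X ⟨hX, hXm⟩
    obtain ⟨D, hDU, hDX, hD, hDc⟩ := h X hX hXm
    obtain ⟨v, hv⟩ := hD.1
    have hDs : D ⊆ U \ X := Finset.subset_sdiff.2 ⟨hDU, hDX⟩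
    obtain ⟨C, hCs, hvC, hC, hcl⟩ := CutConnected.exists_component (G := G) (hDs hv)
    have hDC : D ⊆ C := hD.2 C ⟨v, hv, hvC⟩ fun a _ haC b hb hab => hcl a haC b (hDs hb) hab
    obtain ⟨h1, h2⟩ := Finset.subset_sdiff.1 hCs
    refine ⟨C, h1, h2, hC, fun u hu w hw hwX => hcl u hu w (Finset.mem_sdiff.2 ⟨hw, hwX⟩), ?_⟩
    have := Finset.card_le_card hDC
    omega
  choose! β h1 h2 h3 h4 h5 using h'
  refine ⟨β, fun X hX hm => h1 X ⟨hX, hm⟩, fun X hX hm => h2 X ⟨hX, hm⟩,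
    fun X hX hm => h3 X ⟨hX, hm⟩, fun X hX hm => h4 X ⟨hX, hm⟩, fun X Y hXY hY hm => ?_⟩
  have hX : X ⊆ U ∧ X.card ≤ m := ⟨hXY.trans hY, (Finset.card_le_card hXY).trans hm⟩
  refine (h3 Y ⟨hY, hm⟩).2 _ ?_ fun u _ huX w hw huw => h4 X hX u huX w (h1 Y ⟨hY, hm⟩ hw)
    (fun hwX => Finset.disjoint_left.1 (h2 Y ⟨hY, hm⟩) hw (hXY hwX)) huw
  have hi := Finset.card_union_add_card_inter (β Y) (β X)
  have hu := Finset.card_le_card (Finset.union_subset (h1 Y ⟨hY, hm⟩) (h1 X hX))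
  have := h5 X hX
  have := h5 Y ⟨hY, hm⟩
  obtain ⟨v, hv⟩ := Finset.card_pos.1 (show 0 < (β Y ∩ β X).card by omega)
  exact ⟨v, Finset.mem_inter.1 hv⟩

/-- The data maintained while searching for a covey: `X` is a small part of the covey `F`, and the
haven lives away from `F`. -/
structure IsTethered {V : Type*} (G : SimpleGraph V) (U : Finset V) (t : ℕ)
    (β : Finset V → Finset V) (F : Finset (Finset V)) (X : Finset V) : Prop where
  covey : IsCovey G F
  subset : X ⊆ U
  cover : ∀ x ∈ X, ∃ C ∈ F, x ∈ C
  small : ∀ C ∈ F, (X ∩ C).card ≤ t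
  disjoint : ∀ C ∈ F, Disjoint C (β X)

theorem IsTethered.card_le {V : Type*} {G : SimpleGraph V} {U : Finset V} {t : ℕ}
    {β : Finset V → Finset V} {F : Finset (Finset V)} {X : Finset V}
    (h : IsTethered G U t β F X) : X.card ≤ F.card * t := by
  have : X ⊆ F.biUnion fun C => X ∩ C := by
    intro x hx
    obtain ⟨C, hC, hxC⟩ := h.cover x hx
    exact Finset.mem_biUnion.2 ⟨C, hC, Finset.mem_inter.2 ⟨hx, hxC⟩⟩
  exact (Finset.card_le_card this).trans (Finset.card_biUnion_le_card_mul _ _ _ h.small)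

/-- Dropping a member of the covey without neighbours in the haven. -/
theorem IsTethered.erase {V : Type*} {G : SimpleGraph V} {U : Finset V} {m t : ℕ}
    {β : Finset V → Finset V} (hβ : IsHaven G U m β) {F : Finset (Finset V)} {X : Finset V}
    (h : IsTethered G U t β F X) (hX : X.card ≤ m) {C : Finset V}
    (hC : ∀ u ∈ C, ∀ v ∈ β X, ¬ G.Adj u v) :
    IsTethered G U t β (F.erase C) (X \ C) ∧ β (X \ C) ⊆ β X := by
  have hXs : X \ C ⊆ X := Finset.sdiff_subset
  have hX' : (X \ C).card ≤ m := (Finset.card_le_card hXs).trans hX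
  have hU' := hXs.trans h.subset
  have hsub : β (X \ C) ⊆ β X := by
    refine (hβ.connected _ hU' hX').2 _ ?_ ?_
    · obtain ⟨v, hv⟩ := (hβ.connected X h.subset hX).1
      exact ⟨v, hβ.anti _ _ hXs h.subset hX hv, hv⟩
    · intro u _ hu w hw huw
      by_cases hwX : w ∈ X
      · have hwC : w ∉ C := fun hwC => hC w hwC u hu huw.symm
        exact absurd (Finset.mem_sdiff.2 ⟨hwX, hwC⟩)
          (Finset.disjoint_left.1 (hβ.disjoint _ hU' hX') hw)
      · exact hβ.closed X h.subset hX u hu w (hβ.subset _ hU' hX' hw) hwX huw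
  refine ⟨⟨h.covey.mono (Finset.erase_subset _ _), hU', ?_, ?_, ?_⟩, hsub⟩
  · intro x hx
    obtain ⟨hx, hxC⟩ := Finset.mem_sdiff.1 hx
    obtain ⟨D, hD, hxD⟩ := h.cover x hx
    exact ⟨D, Finset.mem_erase.2 ⟨fun e => hxC (e ▸ hxD), hD⟩, hxD⟩
  · intro D hD
    exact (Finset.card_le_card (Finset.inter_subset_inter_right hXs)).trans
      (h.small D (Finset.mem_of_mem_erase hD))
  · intro D hD
    exact (h.disjoint D (Finset.mem_of_mem_erase hD)).mono_right hsub

/-- Adding to the covey a small connected subset of the haven adjacent to every member. -/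
theorem IsTethered.extend {V : Type*} {G : SimpleGraph V} {U : Finset V} {m t : ℕ}
    {β : Finset V → Finset V} (hβ : IsHaven G U m β) {F : Finset (Finset V)} {X : Finset V}
    (h : IsTethered G U t β F X) (hX : X.card + t ≤ m) {T : Finset V} (hTβ : T ⊆ β X)
    (hT : CutConnected G T) (hTt : T.card ≤ t)
    (ha : ∀ C ∈ F, ∃ u ∈ C, ∃ v ∈ T, G.Adj u v) :
    IsTethered G U t β (insert T F) (X ∪ T) ∧ T ∉ F ∧
      (β (X ∪ T)).card + T.card ≤ (β X).card := by
  have hXm : X.card ≤ m := by omega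
  have hX' : (X ∪ T).card ≤ m := (Finset.card_union_le _ _).trans (by omega)
  have hU' : X ∪ T ⊆ U :=
    Finset.union_subset h.subset (hTβ.trans (hβ.subset _ h.subset hXm))
  have hd : ∀ C ∈ F, Disjoint C T := fun C hC => (h.disjoint C hC).mono_right hTβ
  have hXT : Disjoint T X := (hβ.disjoint X h.subset hXm).mono_left hTβ
  have hanti := hβ.anti X (X ∪ T) Finset.subset_union_left hU' hX'
  have hdT : Disjoint (β (X ∪ T)) T :=
    (hβ.disjoint _ hU' hX').mono_right Finset.subset_union_right
  refine ⟨⟨h.covey.insert hT hd ha, hU', ?_, ?_, ?_⟩, ?_, ?_⟩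
  · intro x hx
    rcases Finset.mem_union.1 hx with hx | hx
    · obtain ⟨C, hC, hxC⟩ := h.cover x hx
      exact ⟨C, Finset.mem_insert_of_mem hC, hxC⟩
    · exact ⟨T, Finset.mem_insert_self _ _, hx⟩
  · intro C hC
    rcases Finset.mem_insert.1 hC with rfl | hC
    · exact (Finset.card_le_card Finset.inter_subset_right).trans hTt
    · rw [Finset.union_inter_distrib_right, Finset.disjoint_iff_inter_eq_empty.1 (hd C hC).symm,
        Finset.union_empty]
      exact h.small C hC
  · intro C hC
    rcases Finset.mem_insert.1 hC with rfl | hC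
    · exact hdT.symm
    · exact (h.disjoint C hC).mono_right hanti
  · intro hTF
    obtain ⟨v, hv⟩ := hT.1
    exact Finset.disjoint_left.1 (hd T hTF) hv hv
  · rw [← Finset.card_union_of_disjoint hdT]
    exact Finset.card_le_card (Finset.union_subset hanti hTβ)

/-- Enlarging a member of the covey that has no neighbours in the part of the haven beyond a small
separator `Z`. -/
theorem IsTethered.enlarge {V : Type*} {G : SimpleGraph V} {U : Finset V} {m t : ℕ}
    {β : Finset V → Finset V} (hβ : IsHaven G U m β) {F : Finset (Finset V)} {X : Finset V}
    (h : IsTethered G U t β F X) (hX : X.card + t ≤ m) {Z : Finset V} (hZβ : Z ⊆ β X)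
    (hZt : Z.card ≤ t) {C : Finset V} (hC : C ∈ F)
    (hCn : ∃ u ∈ C, ∃ v ∈ β X, G.Adj u v)
    (hCZ : ∀ u ∈ C, ∀ v ∈ β (X ∪ Z), ¬ G.Adj u v) :
    ∃ F' X', IsTethered G U t β F' X' ∧ F'.card ≤ F.card ∧
      X'.card + 3 * (β X').card < X.card + 3 * (β X).card := by
  have hXm : X.card ≤ m := by omega
  have hXZ : (X ∪ Z).card ≤ m := (Finset.card_union_le _ _).trans (by omega)
  have hXZU : X ∪ Z ⊆ U :=
    Finset.union_subset h.subset (hZβ.trans (hβ.subset _ h.subset hXm))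
  have hKB := hβ.anti X (X ∪ Z) Finset.subset_union_left hXZU hXZ
  obtain ⟨c, hc⟩ := (h.covey.connected C hC).1
  have hcS : c ∈ C ∪ (β X \ β (X ∪ Z)) := Finset.mem_union_left _ hc
  obtain ⟨D, hDs, hcD, hD, hDcl⟩ := CutConnected.exists_component (G := G) hcS
  have hCD : C ⊆ D := (h.covey.connected C hC).2 D ⟨c, hc, hcD⟩ fun a _ haD b hb hab =>
    hDcl a haD b (Finset.mem_union_left _ hb) hab
  have hCB := h.disjoint C hC
  have hBX := hβ.disjoint X h.subset hXm
  have hDB : ∀ w ∈ D, w ∈ β X → w ∉ β (X ∪ Z) := by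
    intro w hwD hwB
    rcases Finset.mem_union.1 (hDs hwD) with hw | hw
    · exact absurd hwB (Finset.disjoint_left.1 hCB hw)
    · exact (Finset.mem_sdiff.1 hw).2
  have hDC : ∀ w ∈ D, w ∉ C → w ∈ β X := by
    intro w hwD hwC
    rcases Finset.mem_union.1 (hDs hwD) with hw | hw
    · exact absurd hw hwC
    · exact (Finset.mem_sdiff.1 hw).1
  set X' := (X \ C) ∪ (Z ∩ D) with hX'def
  have hX's : X' ⊆ X ∪ Z :=
    Finset.union_subset_union Finset.sdiff_subset Finset.inter_subset_left
  have hX'U := hX's.trans hXZU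
  have hX'm := (Finset.card_le_card hX's).trans hXZ
  have hK' : β X' ⊆ β X \ D := by
    refine (hβ.connected X' hX'U hX'm).2 _ ?_ ?_
    · obtain ⟨v, hv⟩ := (hβ.connected _ hXZU hXZ).1
      exact ⟨v, hβ.anti _ _ hX's hXZU hXZ hv,
        Finset.mem_sdiff.2 ⟨hKB hv, fun hvD => hDB v hvD (hKB hv) hv⟩⟩
    · intro u _ hu w hw huw
      obtain ⟨huB, huD⟩ := Finset.mem_sdiff.1 hu
      have hwU := hβ.subset _ hX'U hX'm hw
      have hwX' : w ∉ X' := Finset.disjoint_left.1 (hβ.disjoint _ hX'U hX'm) hw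
      have huK : ∀ a ∈ D, G.Adj u a → u ∈ β (X ∪ Z) := by
        intro a haD hua
        by_contra huK
        exact huD (hDcl a haD u
          (Finset.mem_union_right _ (Finset.mem_sdiff.2 ⟨huB, huK⟩)) hua.symm)
      have hwX : w ∉ X := by
        intro hwX
        have hwC : w ∈ C := by
          by_contra hwC
          exact hwX' (Finset.mem_union_left _ (Finset.mem_sdiff.2 ⟨hwX, hwC⟩))
        exact hCZ w hwC u (huK w (hCD hwC) huw) huw.symm
      have hwB := hβ.closed X h.subset hXm u huB w hwU hwX huw
      refine Finset.mem_sdiff.2 ⟨hwB, fun hwD => ?_⟩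
      have hwZ : w ∉ Z := fun hwZ =>
        hwX' (Finset.mem_union_right _ (Finset.mem_inter.2 ⟨hwZ, hwD⟩))
      exact hDB w hwD hwB (hβ.closed _ hXZU hXZ u (huK w hwD huw) w hwU
        (by simp [hwX, hwZ]) huw)
  obtain ⟨hK'B, hK'D⟩ := Finset.subset_sdiff.1 hK'
  have hother : ∀ C' ∈ F.erase C, Disjoint C' D := by
    intro C' hC'
    obtain ⟨hne, hC'⟩ := Finset.mem_erase.1 hC'
    refine Finset.disjoint_left.2 fun x hx hxD => ?_
    exact Finset.disjoint_left.1 (h.disjoint C' hC') hx (hDC x hxD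
      (Finset.disjoint_left.1 (h.covey.disjoint C' hC' C hC hne) hx))
  refine ⟨insert D (F.erase C), X', ⟨?_, hX'U, ?_, ?_, ?_⟩, ?_, ?_⟩
  · refine (h.covey.mono (Finset.erase_subset _ _)).insert hD hother fun C' hC' => ?_
    obtain ⟨hne, hC'⟩ := Finset.mem_erase.1 hC'
    obtain ⟨u, hu, v, hv, huv⟩ := h.covey.adj C' hC' C hC hne
    exact ⟨u, hu, v, hCD hv, huv⟩
  · intro x hx
    rcases Finset.mem_union.1 hx with hx | hx
    · obtain ⟨hxX, hxC⟩ := Finset.mem_sdiff.1 hx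
      obtain ⟨E, hE, hxE⟩ := h.cover x hxX
      exact ⟨E, Finset.mem_insert_of_mem
        (Finset.mem_erase.2 ⟨fun e => hxC (e ▸ hxE), hE⟩), hxE⟩
    · exact ⟨D, Finset.mem_insert_self _ _, (Finset.mem_inter.1 hx).2⟩
  · intro E hE
    rcases Finset.mem_insert.1 hE with rfl | hE
    · refine (Finset.card_le_card fun x hx => ?_).trans hZt
      obtain ⟨hx, hxD⟩ := Finset.mem_inter.1 hx
      rcases Finset.mem_union.1 hx with hx | hx
      · obtain ⟨hxX, hxC⟩ := Finset.mem_sdiff.1 hx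
        exact absurd hxX (Finset.disjoint_left.1 hBX (hDC x hxD hxC))
      · exact (Finset.mem_inter.1 hx).1
    · have hEF := Finset.mem_of_mem_erase hE
      refine (Finset.card_le_card fun x hx => ?_).trans (h.small E hEF)
      obtain ⟨hx, hxE⟩ := Finset.mem_inter.1 hx
      rcases Finset.mem_union.1 hx with hx | hx
      · exact Finset.mem_inter.2 ⟨(Finset.mem_sdiff.1 hx).1, hxE⟩
      · exact absurd (hZβ (Finset.mem_inter.1 hx).1)
          (Finset.disjoint_left.1 (h.disjoint E hEF) hxE)
  · intro E hE
    rcases Finset.mem_insert.1 hE with rfl | hE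
    · exact hK'D.symm
    · exact (h.disjoint E (Finset.mem_of_mem_erase hE)).mono_right hK'B
  · have := Finset.card_insert_le D (F.erase C)
    have := Finset.card_erase_add_one hC
    omega
  · obtain ⟨u, hu, v, hv, huv⟩ := hCn
    have hvD : v ∈ D := hDcl u (hCD hu) v (Finset.mem_union_right _
      (Finset.mem_sdiff.2 ⟨hv, fun hvK => hCZ u hu v hvK huv⟩)) huv
    have h1 : 0 < (β X ∩ D).card := Finset.card_pos.2 ⟨v, Finset.mem_inter.2 ⟨hv, hvD⟩⟩
    have h2 : X'.card ≤ X.card + (β X ∩ D).card := by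
      refine (Finset.card_union_le _ _).trans (Nat.add_le_add
        (Finset.card_le_card Finset.sdiff_subset) (Finset.card_le_card ?_))
      exact Finset.inter_subset_inter_right hZβ
    have h3 := Finset.card_le_card hK'
    have h4 := Finset.card_sdiff_add_card_inter (β X) D
    omega

/-- A graph with a haven of large order has a large covey. -/
theorem IsHaven.exists_covey {V : Type*} {G : SimpleGraph V} {U : Finset V} {r t : ℕ}
    {β : Finset V → Finset V} (hβ : IsHaven G U (r * t) β) (hr : 1 ≤ r) (ht : 1 ≤ t)
    (hrt : r * U.card ≤ t ^ 2) : ∃ F, IsCovey G F ∧ F.card = r := by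
  by_contra! hno
  have key : ∀ N F X, IsTethered G U t β F X → F.card < r →
      F.card + X.card + 3 * (β X).card ≤ N → False := by
    intro N
    induction N using Nat.strong_induction_on with
    | _ N ih =>
    intro F X h hF hN
    have hXt : X.card + t ≤ r * t := by
      have h1 := h.card_le
      have h2 : (F.card + 1) * t ≤ r * t := Nat.mul_le_mul_right t hF
      rw [Nat.add_mul, one_mul] at h2
      omega
    have hX : X.card ≤ r * t := by omega
    by_cases hA : ∃ C ∈ F, ∀ u ∈ C, ∀ v ∈ β X, ¬ G.Adj u v
    · obtain ⟨C, hCF, hC⟩ := hA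
      obtain ⟨h', hsub⟩ := h.erase hβ hX hC
      have h1 := Finset.card_le_card hsub
      have h2 : (X \ C).card ≤ X.card := Finset.card_le_card Finset.sdiff_subset
      have h3 := Finset.card_erase_add_one hCF
      exact ih _ (by omega) _ _ h' (by omega) le_rfl
    push Not at hA
    rcases exists_connected_or_separator' G (β X) F
      (fun C => (β X).filter fun v => ∃ u ∈ C, G.Adj u v) t ht with
      ⟨T, hTB, hT, hTt, hTA⟩ | ⟨Z, hZB, hZt, hZ⟩
    · obtain ⟨h', hTF, hc⟩ := h.extend hβ hXt hTB hT hTt fun C hC => by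
        obtain ⟨x, hx, hxA⟩ := hTA C hC
        obtain ⟨u, hu, hux⟩ := (Finset.mem_filter.1 hxA).2
        exact ⟨u, hu, x, hx, hux⟩
      have h1 := Finset.card_insert_of_notMem hTF
      have h2 := hno _ h'.covey
      have h3 := Finset.card_union_le X T
      have h4 := Finset.card_pos.2 hT.1
      exact ih _ (by omega) _ _ h' (by omega) le_rfl
    · have hZt' : Z.card ≤ t := by
        have h1 : F.card * (β X).card ≤ r * U.card :=
          Nat.mul_le_mul hF.le (Finset.card_le_card (hβ.subset X h.subset hX))
        refine Nat.le_of_mul_le_mul_left (?_ : t * Z.card ≤ t * t) ht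
        rw [← sq]
        omega
      have hXZ : (X ∪ Z).card ≤ r * t := (Finset.card_union_le _ _).trans (by omega)
      have hXZU : X ∪ Z ⊆ U :=
        Finset.union_subset h.subset (hZB.trans (hβ.subset _ h.subset hX))
      have hKB := hβ.anti X (X ∪ Z) Finset.subset_union_left hXZU hXZ
      obtain ⟨C, hC, hd⟩ := hZ _ hKB (hβ.connected _ hXZU hXZ)
        ((hβ.disjoint _ hXZU hXZ).mono_right Finset.subset_union_right)
      obtain ⟨F', X', h', hF', hlt⟩ := h.enlarge hβ hXt hZB hZt' hC (hA C hC)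
        fun u hu v hv huv => Finset.disjoint_left.1 hd hv
          (Finset.mem_filter.2 ⟨hKB hv, u, hu, huv⟩)
      exact ih _ (by omega) _ _ h' (by omega) le_rfl
  exact key _ ∅ ∅ ⟨⟨by simp, by simp, by simp⟩, by simp, by simp, by simp, by simp⟩
    (by rwa [Finset.card_empty]) le_rfl

/-- The Alon–Seymour–Thomas separator theorem. -/
theorem exists_balanced_separator {V : Type*} {G : SimpleGraph V} {r : ℕ}
    {H : SimpleGraph (Fin r)} (hG : ¬ HasMinor G H) (hr : 1 ≤ r) (U : Finset V) {t : ℕ}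
    (ht : 1 ≤ t) (hrt : r * U.card ≤ t ^ 2) :
    ∃ X ⊆ U, X.card ≤ r * t ∧
      ∀ D ⊆ U, Disjoint D X → CutConnected G D → 2 * D.card ≤ U.card := by
  by_contra! h
  obtain ⟨β, hβ⟩ := exists_isHaven h
  obtain ⟨F, hF, hFr⟩ := hβ.exists_covey hr ht hrt
  exact hG (hF.hasMinor hFr H)

theorem exists_nat_sq_between {x : ℝ} (hx : 1 ≤ x) :
    ∃ t : ℕ, 1 ≤ t ∧ x ≤ (t : ℝ) ^ 2 ∧ (t : ℝ) ^ 2 ≤ 4 * x := by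
  have hs : 1 ≤ √x := Real.one_le_sqrt.2 hx
  have hsq : √x ^ 2 = x := Real.sq_sqrt (by linarith)
  have h1 := Nat.le_ceil √x
  have h2 := Nat.ceil_lt_add_one (Real.sqrt_nonneg x)
  refine ⟨⌈√x⌉₊, Nat.one_le_ceil_iff.2 (by linarith), ?_, ?_⟩ <;> nlinarith

/-- Balanced separators of large vertex sets are relatively small: if `64 r³ ≤ A² k` and `U` has
more than `k 2 ^ j` vertices, one of them costs at most `A / 4 * 2 ^ (-j / 2)` per vertex. -/
theorem exists_balanced_separator_of_lt {V : Type*} {G : SimpleGraph V} {r : ℕ}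
    {H : SimpleGraph (Fin r)} (hG : ¬ HasMinor G H) (hr : 1 ≤ r) {k : ℕ} {A u : ℝ}
    (hA : 0 ≤ A) (hAk : 64 * (r : ℝ) ^ 3 ≤ A ^ 2 * k) (hu : 0 ≤ u) (hu2 : u ^ 2 = 1 / 2) {j : ℕ}
    {U : Finset V} (hU : k * 2 ^ j < U.card) :
    ∃ X ⊆ U, (X.card : ℝ) ≤ A / 4 * u ^ j * U.card ∧
      ∀ D ⊆ U, Disjoint D X → CutConnected G D → 2 * D.card ≤ U.card := by
  have hr' : (1 : ℝ) ≤ r := by exact_mod_cast hr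
  have hN : (1 : ℝ) ≤ U.card := by exact_mod_cast (by omega : 1 ≤ U.card)
  obtain ⟨t, ht1, ht2, ht3⟩ := exists_nat_sq_between
    (x := r * U.card) (one_le_mul_of_one_le_of_one_le hr' hN)
  obtain ⟨X, hXU, hX, hD⟩ := exists_balanced_separator hG hr U ht1 (by exact_mod_cast ht2)
  refine ⟨X, hXU, ?_, hD⟩
  have hX' : (X.card : ℝ) ≤ r * t := by exact_mod_cast hX
  refine hX'.trans (abs_le_of_sq_le_sq' ?_ (by positivity)).2
  have hU' : (k : ℝ) * 2 ^ j ≤ U.card := by exact_mod_cast hU.le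
  have huj : (u ^ j) ^ 2 * 2 ^ j = 1 := by
    rw [← pow_mul, mul_comm j 2, pow_mul, hu2, ← mul_pow]
    norm_num
  calc ((r : ℝ) * t) ^ 2 = (r : ℝ) ^ 2 * (t : ℝ) ^ 2 := by ring
    _ ≤ (r : ℝ) ^ 2 * (4 * (r * U.card)) := by gcongr
    _ = 64 * (r : ℝ) ^ 3 * (U.card / 16) := by ring
    _ ≤ A ^ 2 * k * (U.card / 16) := by gcongr
    _ = A ^ 2 / 16 * U.card * ((u ^ j) ^ 2) * (k * 2 ^ j) := by
      linear_combination (-(A ^ 2 * k * (U.card / 16))) * huj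
    _ ≤ A ^ 2 / 16 * U.card * ((u ^ j) ^ 2) * U.card := by gcongr
    _ = (A / 4 * u ^ j * U.card) ^ 2 := by ring

/-- If small vertex sets break up every connected subset of `S`, then so do they for `S`. -/
theorem exists_division_of_connected {V : Type*} {G : SimpleGraph V} {k : ℕ} {b : ℝ}
    {S : Finset V}
    (h : ∀ C ⊆ S, CutConnected G C → ∃ X ⊆ C, (X.card : ℝ) ≤ b * C.card ∧
      ∀ D ⊆ C, Disjoint D X → CutConnected G D → D.card ≤ k) :
    ∃ X ⊆ S, (X.card : ℝ) ≤ b * S.card ∧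
      ∀ D ⊆ S, Disjoint D X → CutConnected G D → D.card ≤ k := by
  induction S using Finset.strongInduction with
  | H S ih =>
  rcases S.eq_empty_or_nonempty with rfl | ⟨v, hv⟩
  · refine ⟨∅, by simp, by simp, fun D hD _ hc => ?_⟩
    rw [Finset.subset_empty.1 hD] at hc
    exact absurd hc.1 Finset.not_nonempty_empty
  obtain ⟨C, hCS, hvC, hC, hcl⟩ := CutConnected.exists_component (G := G) hv
  have hss : S \ C ⊂ S := Finset.sdiff_ssubset hCS ⟨v, hvC⟩
  obtain ⟨X, hXC, hX, hXD⟩ := h C hCS hC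
  obtain ⟨Y, hYC, hY, hYD⟩ := ih (S \ C) hss fun E hE => h E (hE.trans hss.1)
  refine ⟨X ∪ Y, Finset.union_subset (hXC.trans hCS) (hYC.trans hss.1), ?_, ?_⟩
  · have h1 : ((X ∪ Y).card : ℝ) ≤ X.card + Y.card := by exact_mod_cast Finset.card_union_le X Y
    have h2 : ((S \ C).card : ℝ) + C.card = S.card := by
      exact_mod_cast Finset.card_sdiff_add_card_eq_card hCS
    rw [← h2]
    linarith
  · intro D hDS hDX hD
    obtain ⟨hDX, hDY⟩ := Finset.disjoint_union_right.1 hDX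
    by_cases hDC : Disjoint D C
    · exact hYD D (Finset.subset_sdiff.2 ⟨hDS, hDC⟩) hDY hD
    · obtain ⟨a, ha, haC⟩ := Finset.not_disjoint_iff.1 hDC
      exact hXD D (hD.2 C ⟨a, ha, haC⟩ fun a _ haC b hb hab => hcl a haC b (hDS hb) hab) hDX hD

theorem exists_division {V : Type*} {G : SimpleGraph V} {r : ℕ}
    {H : SimpleGraph (Fin r)} (hG : ¬ HasMinor G H) (hr : 1 ≤ r) {k : ℕ} {A u : ℝ}
    (hA : 0 ≤ A) (hAk : 64 * (r : ℝ) ^ 3 ≤ A ^ 2 * k) (hu : 0 ≤ u) (hu2 : u ^ 2 = 1 / 2) (j : ℕ) :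
    ∀ S : Finset V, (∀ D ⊆ S, CutConnected G D → D.card ≤ k * 2 ^ j) →
      ∃ X ⊆ S, (X.card : ℝ) ≤ A * (1 - u ^ j) * S.card ∧
        ∀ D ⊆ S, Disjoint D X → CutConnected G D → D.card ≤ k := by
  induction j with
  | zero => exact fun S hS => ⟨∅, by simp, by simp, fun D hD _ hc => by simpa using hS D hD hc⟩
  | succ j ih =>
    intro S hS
    have hu34 : u ≤ 3 / 4 := by nlinarith
    have hstep : A * (1 - u ^ j) + A / 4 * u ^ j ≤ A * (1 - u ^ (j + 1)) := by
      have : 0 ≤ A * u ^ j * (3 / 4 - u) := mul_nonneg (by positivity) (by linarith)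
      rw [pow_succ]
      linarith
    refine exists_division_of_connected fun C hCS hC => ?_
    by_cases hCk : C.card ≤ k * 2 ^ j
    · obtain ⟨X, hXC, hX, hD⟩ := ih C fun D hD _ => (Finset.card_le_card hD).trans hCk
      refine ⟨X, hXC, hX.trans ?_, hD⟩
      have : 0 ≤ A / 4 * u ^ j := by positivity
      exact mul_le_mul_of_nonneg_right (by linarith) (Nat.cast_nonneg _)
    · obtain ⟨X, hXC, hX, hXD⟩ :=
        exists_balanced_separator_of_lt hG hr hA hAk hu hu2 (not_le.1 hCk)
      have hCcard := hS C hCS hC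
      obtain ⟨Y, hYC, hY, hYD⟩ := ih (C \ X) fun D hD hDc => by
        obtain ⟨h1, h2⟩ := Finset.subset_sdiff.1 hD
        have := hXD D h1 h2 hDc
        rw [pow_succ] at hCcard
        lia
      refine ⟨X ∪ Y, Finset.union_subset hXC (hYC.trans Finset.sdiff_subset), ?_, ?_⟩
      · have h1 : ((X ∪ Y).card : ℝ) ≤ X.card + Y.card := by
          exact_mod_cast Finset.card_union_le X Y
        have h2 : ((C \ X).card : ℝ) ≤ C.card := by
          exact_mod_cast Finset.card_le_card Finset.sdiff_subset
        have h3 : 0 ≤ A * (1 - u ^ j) :=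
          mul_nonneg hA (sub_nonneg.2 (pow_le_one₀ hu (by linarith)))
        calc ((X ∪ Y).card : ℝ) ≤ X.card + Y.card := h1
          _ ≤ A / 4 * u ^ j * C.card + A * (1 - u ^ j) * C.card :=
            add_le_add hX (hY.trans (by gcongr))
          _ = (A * (1 - u ^ j) + A / 4 * u ^ j) * C.card := by ring
          _ ≤ A * (1 - u ^ (j + 1)) * C.card := by gcongr
      · intro D hDC hDX hD
        obtain ⟨hDX, hDY⟩ := Finset.disjoint_union_right.1 hDX
        exact hYD D (Finset.subset_sdiff.2 ⟨hDC, hDX⟩) hDY hD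

theorem exists_vertex_division {V : Type*} [Fintype V] {G : SimpleGraph V} {r : ℕ}
    {H : SimpleGraph (Fin r)} (hG : ¬ HasMinor G H) (hr : 1 ≤ r) {k : ℕ} (hk : 1 ≤ k) {A : ℝ}
    (hA : 0 ≤ A) (hAk : 64 * (r : ℝ) ^ 3 ≤ A ^ 2 * k) :
    ∃ X : Finset V, (X.card : ℝ) ≤ A * Fintype.card V ∧
      ∀ D, Disjoint D X → CutConnected G D → D.card ≤ k := by
  obtain ⟨X, -, hX, hD⟩ := exists_division hG hr hA hAk (Real.sqrt_nonneg (1 / 2))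
    (Real.sq_sqrt (by norm_num)) (Fintype.card V) Finset.univ fun D _ _ =>
      (Finset.card_le_univ D).trans (Nat.lt_two_pow_self.le.trans (Nat.le_mul_of_pos_left _ hk))
  refine ⟨X, hX.trans ?_, fun D => hD D (Finset.subset_univ D)⟩
  rw [Finset.card_univ]
  refine mul_le_mul_of_nonneg_right ?_ (Nat.cast_nonneg _)
  have : 0 ≤ A * √(1 / 2) ^ Fintype.card V := by positivity
  linarith

/-- Deleting all edges at a vertex set that breaks `G` into small pieces leaves small components. -/
theorem ncard_supp_deleteEdges_le {V : Type*} [Fintype V] {G : SimpleGraph V} {X : Finset V}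
    {R : Set (Sym2 V)} {k : ℕ} (hk : 1 ≤ k) (hR : ∀ x ∈ X, ∀ y, G.Adj x y → s(x, y) ∈ R)
    (hX : ∀ D, Disjoint D X → CutConnected G D → D.card ≤ k)
    (c : (G.deleteEdges R).ConnectedComponent) : c.supp.ncard ≤ k := by
  rw [Set.ncard_eq_toFinset_card']
  have hc : CutConnected (G.deleteEdges R) c.supp.toFinset := by
    apply CutConnected.of_connected_induce
    rw [Set.coe_toFinset]
    exact c.connected_toSimpleGraph
  by_cases hd : Disjoint c.supp.toFinset X
  · exact hX _ hd ⟨hc.1, fun P hP hcl => hc.2 P hP fun u hu huP w hw huw =>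
      hcl u hu huP w hw (G.deleteEdges_le R huw)⟩
  · obtain ⟨x, hx, hxX⟩ := Finset.not_disjoint_iff.1 hd
    have := hc.2 {x} ⟨x, hx, Finset.mem_singleton_self x⟩ fun u _ hux w _ huw => by
      rw [Finset.mem_singleton] at hux
      subst hux
      rw [SimpleGraph.deleteEdges_adj] at huw
      exact absurd (hR u hxX w huw.1) huw.2
    exact (Finset.card_le_card this).trans (by simpa using hk)

/-- an `H`-minor-free graph has, for every `ℓ ≥ α r³`, a set `R` of at most
`α d n / ℓ³` edges whose removal leaves components of size at most `r³ ℓ⁶`. -/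
theorem ast_edge_decomposition :
    ∃ α : ℝ, 0 < α ∧
      ∀ (r n d : ℕ) (H : SimpleGraph (Fin r))
        (V : Type) [Fintype V] [DecidableEq V]
        (G : SimpleGraph V) [DecidableRel G.Adj],
        Fintype.card V = n → 1 ≤ d → (∀ v, G.degree v ≤ d) →
        ¬ HasMinor G H →
        ∀ ℓ : ℕ, α * (r : ℝ) ^ 3 ≤ (ℓ : ℝ) →
          ∃ R : Finset (Sym2 V), ↑R ⊆ G.edgeSet ∧
            (R.card : ℝ) ≤ α * d * n / (ℓ : ℝ) ^ 3 ∧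
            ∀ c : (G.deleteEdges ↑R).ConnectedComponent, c.supp.ncard ≤ r ^ 3 * ℓ ^ 6 := by
  refine ⟨8, by norm_num, ?_⟩
  intro r n d H V _ _ G _ hn _ hdeg hG ℓ hℓ
  have hr : 1 ≤ r := by
    by_contra hr
    obtain rfl : r = 0 := by omega
    exact hG ⟨fun _ => ∅, fun w => w.elim0, fun w => w.elim0, fun w => w.elim0,
      fun w => w.elim0⟩
  have hr' : (1 : ℝ) ≤ r := by exact_mod_cast hr
  have hℓ' : (0 : ℝ) < ℓ := lt_of_lt_of_le (by positivity) hℓ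
  have hk : 1 ≤ r ^ 3 * ℓ ^ 6 :=
    Nat.mul_pos (pow_pos hr 3) (pow_pos (by exact_mod_cast hℓ') 6)
  obtain ⟨X, hX, hD⟩ := exists_vertex_division hG hr hk (A := 8 / (ℓ : ℝ) ^ 3) (by positivity)
    (le_of_eq (by push_cast; field_simp; norm_num))
  refine ⟨X.biUnion fun x => G.incidenceFinset x, ?_, ?_, ?_⟩
  · intro e he
    obtain ⟨x, -, hx⟩ := Finset.mem_biUnion.1 (Finset.mem_coe.1 he)
    exact ((G.mem_incidenceFinset x e).1 hx).1
  · have h1 : (X.biUnion fun x => G.incidenceFinset x).card ≤ X.card * d :=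
      Finset.card_biUnion_le_card_mul _ _ _ fun x _ => by
        rw [G.card_incidenceFinset_eq_degree]
        exact hdeg x
    rw [hn] at hX
    calc ((X.biUnion fun x => G.incidenceFinset x).card : ℝ) ≤ X.card * d := by exact_mod_cast h1
      _ ≤ 8 / (ℓ : ℝ) ^ 3 * n * d := by gcongr
      _ = 8 * d * n / (ℓ : ℝ) ^ 3 := by ring
  · refine ncard_supp_deleteEdges_le hk (fun x hx y hxy => ?_) hD
    rw [Finset.mem_coe]
    exact Finset.mem_biUnion.2 ⟨x, hx, (G.mem_incidenceFinset x _).2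
      ((G.mk'_mem_incidenceSet_left_iff).2 hxy)⟩
end
end
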